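/- arXiv:2110.07286 — 3 statements merged into one kernel-verified Lean document; each statement's English description precedes it below -/
import Mathlib

section
/- For every integer k ≥ 1, the standard k-bit Gray code has transition counts (2^{k−1}, 2^{k−2}, …, 4, 2, 1), and every k-bit Gray code with transition counts (2^{k−1}, 2^{k−2}, …, 4, 2, 1) has the same delta sequence as the standard k-bit Gray code; that is, the standard k-bit Gray code is the unique Gray code with these transition counts up to the choice of starting node. -/
/-- The predecessor-endpoint of the `i`-th consecutive pair in a sequence of
length `2 ^ k`. -/
def finLo (k : ℕ) (i : Fin (2 ^ k - 1)) : Fin (2 ^ k) :=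
  ⟨i.val, by have h := i.isLt; have h2 : 0 < 2 ^ k := pow_pos (by norm_num) k; omega⟩

/-- The successor-endpoint of the `i`-th consecutive pair in a sequence of
length `2 ^ k`. -/
def finHi (k : ℕ) (i : Fin (2 ^ k - 1)) : Fin (2 ^ k) :=
  ⟨i.val + 1, by have h := i.isLt; have h2 : 0 < 2 ^ k := pow_pos (by norm_num) k; omega⟩

/-- A `k`-bit Gray code: a sequence of `2 ^ k` vectors in `{0,1}^k` in which every
vector occurs exactly once and consecutive vectors differ in exactly one coordinate. -/
def IsGrayCode (k : ℕ) (g : Fin (2 ^ k) → Fin k → Bool) : Prop :=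
  Function.Bijective g ∧
    ∀ i : Fin (2 ^ k - 1), ∃! t : Fin k, g (finLo k i) t ≠ g (finHi k i) t

/-- `D` is the delta sequence of `g`: for each `i`, `D i` is the unique coordinate in
which the `i`-th and `(i+1)`-st vector differ. -/
def IsDeltaOf (k : ℕ) (g : Fin (2 ^ k) → Fin k → Bool)
    (D : Fin (2 ^ k - 1) → Fin k) : Prop :=
  ∀ (i : Fin (2 ^ k - 1)) (t : Fin k), (g (finLo k i) t ≠ g (finHi k i) t) ↔ t = D i

/-- A `k`-bit delta sequence: the delta sequence of some `k`-bit Gray code. -/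
def IsDeltaSequence (k : ℕ) (D : Fin (2 ^ k - 1) → Fin k) : Prop :=
  ∃ g, IsGrayCode k g ∧ IsDeltaOf k g D

/-- Transition counts of a sequence over `Fin k`: the number of occurrences of each symbol. -/
def transCount {m k : ℕ} (D : Fin m → Fin k) (t : Fin k) : ℕ :=
  (Finset.univ.filter fun i => D i = t).card

/-- Transition counts of a Gray code: the number of consecutive pairs differing in
coordinate `t`. -/
def grayTransCount (k : ℕ) (g : Fin (2 ^ k) → Fin k → Bool) (t : Fin k) : ℕ :=
  (Finset.univ.filter fun i : Fin (2 ^ k - 1) => g (finLo k i) t ≠ g (finHi k i) t).card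

/-- The standard (reflected binary) `k`-bit Gray code, whose `i`-th vector is the
binary expansion of `i XOR (i / 2)`; coordinate `0` (row 1) changes most often.
This agrees with the inductive definition: the front facet (last coordinate `0`) is
traversed by the standard `(k-1)`-bit Gray code, then the back facet in reverse order. -/
def standardGray (k : ℕ) : Fin (2 ^ k) → Fin k → Bool :=
  fun i t => Nat.testBit (i.val ^^^ (i.val / 2)) t.val

theorem gw_testBit_succ (i t : ℕ) :
    (Nat.testBit i t ≠ Nat.testBit (i+1) t) ↔ 2 ^ t ∣ i + 1 := by
  have h := Nat.succ_div (a := i) (b := 2 ^ t)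
  simp only [Nat.testBit_eq_decide_div_mod_eq, h]
  split_ifs with hd
  · simp only [hd, iff_true, ne_eq, decide_eq_decide]
    omega
  · simp [hd]

theorem gw_gray_succ (i t : ℕ) :
    (Nat.testBit (i ^^^ (i/2)) t ≠ Nat.testBit ((i+1) ^^^ ((i+1)/2)) t) ↔
      (2 ^ t ∣ i + 1 ∧ ¬ 2 ^ (t+1) ∣ i + 1) := by
  rw [← gw_testBit_succ i t, ← gw_testBit_succ i (t+1)]
  have h1 : 2 ^ (t+1) ∣ i + 1 → 2 ^ t ∣ i + 1 := fun h => (pow_dvd_pow 2 (Nat.le_succ t)).trans h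
  rw [← gw_testBit_succ i t, ← gw_testBit_succ i (t+1)] at h1
  simp only [Nat.testBit_xor, Nat.testBit_div_two]
  revert h1
  generalize i.testBit t = a
  generalize (i+1).testBit t = b
  generalize i.testBit (t+1) = c
  generalize (i+1).testBit (t+1) = d
  revert a b c d
  decide

theorem gw_gray_inj : ∀ x y : ℕ, x ^^^ (x/2) = y ^^^ (y/2) → x = y := by
  intro x
  induction x using Nat.strong_induction_on with
  | _ x ih =>
    intro y h
    have key : x / 2 = y / 2 := by
      rcases Nat.eq_zero_or_pos x with h0 | h0
      · subst h0
        have h2 : y = y / 2 := by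
          have : y ^^^ (y/2) = 0 := by simpa using h.symm
          exact Nat.xor_eq_zero_iff.mp this
        omega
      · apply ih (x/2) (by omega)
        have := congrArg (· / 2) h
        simpa [Nat.xor_div_two] using this
    rw [key] at h
    exact Nat.xor_left_injective h

theorem gw_card_window (P : ℕ → Prop) [DecidablePred P] (w M : ℕ)
    (hP : ∀ a, a + w ≤ M → ∃ i, a ≤ i ∧ i < a + w ∧ P i) :
    ∀ N a, a + N * w ≤ M → N ≤ ((Finset.Ico a (a + N * w)).filter P).card := by
  intro N
  induction N with
  | zero => intro a _; simp
  | succ N ih =>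
    intro a h
    have e : a + (N+1) * w = a + N * w + w := by ring
    rw [e] at h ⊢
    obtain ⟨i, h1, h2, h3⟩ := hP (a + N * w) h
    have h4 := ih a (by omega)
    have hsub : insert i ((Finset.Ico a (a + N * w)).filter P) ⊆
        (Finset.Ico a (a + N * w + w)).filter P := by
      intro x hx
      simp only [Finset.mem_insert, Finset.mem_filter, Finset.mem_Ico] at hx ⊢
      rcases hx with rfl | ⟨hx, hp⟩
      · exact ⟨⟨by omega, by omega⟩, h3⟩
      · exact ⟨⟨by omega, by omega⟩, hp⟩
    have h5 := Finset.card_le_card hsub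
    rw [Finset.card_insert_of_notMem (by simp; omega)] at h5
    omega

theorem gw_dvd (P : ℕ → Prop) [DecidablePred P] (w Q : ℕ) (hw : 0 < w)
    (hP : ∀ a, a + w ≤ w * Q - 1 → ∃ i, a ≤ i ∧ i < a + w ∧ P i)
    (hc : ((Finset.range (w * Q - 1)).filter P).card + 1 ≤ Q)
    (s : ℕ) (hs : s < w * Q - 1) (hPs : P s) : w ∣ s + 1 := by
  by_contra hd
  have hr : 0 < (s+1) % w := Nat.pos_of_ne_zero (fun h => hd (Nat.dvd_of_mod_eq_zero h))
  have hr2 : (s+1) % w < w := Nat.mod_lt _ hw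
  have he := Nat.div_add_mod (s+1) w
  set q := (s+1) / w
  set r := (s+1) % w
  have hq : q < Q := by
    by_contra hh
    have := Nat.mul_le_mul_left w (not_lt.mp hh)
    omega
  obtain ⟨p, rfl⟩ : ∃ p, Q = q + 1 + p := ⟨Q - (q+1), by omega⟩
  have e : w * (q + 1 + p) = w * q + w + p * w := by ring
  have e2 : q * w = w * q := by ring
  rw [e] at hP hc hs
  have c1 := gw_card_window P w _ hP q 0 (by omega)
  have c2 := gw_card_window P w _ hP p (s+1) (by omega)
  have hsub : insert s (((Finset.Ico 0 (0 + q * w)).filter P) ∪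
      ((Finset.Ico (s+1) (s + 1 + p * w)).filter P)) ⊆
      (Finset.range (w * q + w + p * w - 1)).filter P := by
    intro x hx
    simp only [Finset.mem_insert, Finset.mem_union, Finset.mem_filter, Finset.mem_Ico,
      Finset.mem_range] at hx ⊢
    rcases hx with rfl | ⟨hx, hp⟩ | ⟨hx, hp⟩
    · exact ⟨by omega, hPs⟩
    · exact ⟨by omega, hp⟩
    · exact ⟨by omega, hp⟩
  have h5 := Finset.card_le_card hsub
  rw [Finset.card_insert_of_notMem (by simp; omega), Finset.card_union_of_disjoint] at h5
  · omega
  · rw [Finset.disjoint_left]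
    intro x hx hy
    simp only [Finset.mem_filter, Finset.mem_Ico] at hx hy
    omega

theorem gw_fin_card (n : ℕ) (P : ℕ → Prop) [DecidablePred P] :
    (Finset.univ.filter fun i : Fin n => P i.val).card = ((Finset.range n).filter P).card := by
  rw [Finset.card_filter, Finset.card_filter]
  exact Fin.sum_univ_eq_sum_range (fun i => if P i then 1 else 0) n

theorem gw_sub_div (k t : ℕ) (h : t ≤ k) : (2 ^ k - 1) / 2 ^ t = 2 ^ (k - t) - 1 := by
  obtain ⟨d, rfl⟩ := Nat.exists_eq_add_of_le h
  have e : 2 ^ (t + d) = 2 ^ t * 2 ^ d := pow_add _ _ _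
  have hd : 0 < 2 ^ d := by positivity
  have ht : 0 < 2 ^ t := by positivity
  obtain ⟨m, hm⟩ : ∃ m, 2 ^ d = m + 1 := ⟨2 ^ d - 1, by omega⟩
  rw [e, show t + d - t = d by omega, hm]
  rw [Nat.div_eq_iff ht]
  have : 2 ^ t * (m + 1) = m * 2 ^ t + 2 ^ t := by ring
  constructor
  · simp; omega
  · simp; omega

theorem gw_std_iff (k : ℕ) (i : Fin (2 ^ k - 1)) (t : Fin k) :
    (standardGray k (finLo k i) t ≠ standardGray k (finHi k i) t) ↔
      (2 ^ t.val ∣ i.val + 1 ∧ ¬ 2 ^ (t.val+1) ∣ i.val + 1) :=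
  gw_gray_succ i.val t.val

theorem gw_std_gray (k : ℕ) : IsGrayCode k (standardGray k) := by
  constructor
  · rw [Fintype.bijective_iff_injective_and_card]
    refine ⟨?_, by simp⟩
    intro x y h
    apply Fin.ext
    apply gw_gray_inj
    apply Nat.eq_of_testBit_eq
    intro t
    by_cases ht : t < k
    · exact congrFun h ⟨t, ht⟩
    · have hk : 2 ^ k ≤ 2 ^ t := Nat.pow_le_pow_right (by norm_num) (by omega)
      have hb : ∀ z : Fin (2 ^ k), Nat.testBit (z.val ^^^ (z.val / 2)) t = false := by
        intro z
        apply Nat.testBit_lt_two_pow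
        exact lt_of_lt_of_le (Nat.xor_lt_two_pow z.isLt (by have := z.isLt; omega)) hk
      rw [hb, hb]
  · intro i
    obtain ⟨v, m, hm, he⟩ := Nat.exists_eq_two_pow_mul_odd (n := i.val + 1) (by omega)
    have hvk : v < k := by
      by_contra hh
      have h1 : 2 ^ k ≤ 2 ^ v := Nat.pow_le_pow_right (by norm_num) (by omega)
      have h2 : 2 ^ v ≤ i.val + 1 := Nat.le_of_dvd (by omega) ⟨m, he⟩
      have := i.isLt
      omega
    have hn : ¬ 2 ^ (v+1) ∣ i.val + 1 := by
      rw [he, pow_succ, Nat.mul_dvd_mul_iff_left (by positivity)]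
      exact hm.not_two_dvd_nat
    refine ⟨⟨v, hvk⟩, (gw_std_iff k i _).2 ⟨⟨m, he⟩, hn⟩, ?_⟩
    intro t ht
    rw [gw_std_iff] at ht
    apply Fin.ext
    apply le_antisymm
    · by_contra hh
      exact hn ((pow_dvd_pow 2 (by simp at hh; omega)).trans ht.1)
    · by_contra hh
      exact ht.2 ((pow_dvd_pow 2 (by simp at hh; omega)).trans ⟨m, he⟩)

theorem gw_std_count (k : ℕ) (t : Fin k) :
    grayTransCount k (standardGray k) t = 2 ^ (k - 1 - t.val) := by
  unfold grayTransCount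
  simp only [gw_std_iff]
  rw [gw_fin_card (2 ^ k - 1) (fun i => 2 ^ t.val ∣ i + 1 ∧ ¬ 2 ^ (t.val+1) ∣ i + 1)]
  have h1 := Nat.card_multiples (2 ^ k - 1) (2 ^ t.val)
  have h2 := Nat.card_multiples (2 ^ k - 1) (2 ^ (t.val + 1))
  have ht := t.isLt
  rw [gw_sub_div _ _ (by omega)] at h1 h2
  have h3 := Finset.card_filter_add_card_filter_not
    (s := (Finset.range (2 ^ k - 1)).filter fun i => 2 ^ t.val ∣ i + 1)
    (fun i => 2 ^ (t.val + 1) ∣ i + 1)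
  rw [Finset.filter_filter, Finset.filter_filter, h1] at h3
  have h4 : ((Finset.range (2 ^ k - 1)).filter
      fun i => 2 ^ t.val ∣ i + 1 ∧ 2 ^ (t.val + 1) ∣ i + 1) =
      (Finset.range (2 ^ k - 1)).filter fun i => 2 ^ (t.val + 1) ∣ i + 1 := by
    apply Finset.filter_congr
    intro x _
    exact ⟨fun h => h.2, fun h => ⟨(pow_dvd_pow 2 (Nat.le_succ _)).trans h, h⟩⟩
  rw [h4, h2] at h3
  have e : 2 ^ (k - t.val) = 2 * 2 ^ (k - 1 - t.val) := by
    rw [← pow_succ']; congr 1; omega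
  have e2 : k - (t.val + 1) = k - 1 - t.val := by omega
  rw [e, e2] at h3
  have : 0 < 2 ^ (k - 1 - t.val) := by positivity
  omega

theorem gw_sum_delta (k : ℕ) (g : Fin (2 ^ k) → Fin k → Bool) (D : Fin (2 ^ k - 1) → Fin k)
    (hD : IsDeltaOf k g D)
    (hc : ∀ t : Fin k, grayTransCount k g t = 2 ^ (k - 1 - t.val)) (f : Fin k → ℕ) :
    ∑ i, f (D i) = ∑ t : Fin k, 2 ^ (k - 1 - t.val) * f t := by
  rw [← Finset.sum_fiberwise_of_maps_to (s := Finset.univ) (t := Finset.univ) (g := D)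
    (fun _ _ => Finset.mem_univ _)]
  apply Finset.sum_congr rfl
  intro t _
  rw [← hc t, grayTransCount]
  have : (Finset.univ.filter fun i : Fin (2 ^ k - 1) => g (finLo k i) t ≠ g (finHi k i) t)
      = Finset.univ.filter fun i => D i = t := by
    apply Finset.filter_congr
    intro i _
    rw [hD i t, eq_comm]
  rw [this, Finset.sum_congr rfl (g := fun _ => f t)]
  · simp
  · intro i hi
    rw [(Finset.mem_filter.mp hi).2]

theorem gw_window (k : ℕ) (g : Fin (2 ^ k) → Fin k → Bool) (D : Fin (2 ^ k - 1) → Fin k)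
    (hg : IsGrayCode k g) (hD : IsDeltaOf k g D) (j : ℕ) (hj : j ≤ k) (a : ℕ)
    (ha : a + 2 ^ j ≤ 2 ^ k - 1) :
    ∃ i, a ≤ i ∧ i < a + 2 ^ j ∧ ∃ h : i < 2 ^ k - 1, j ≤ (D ⟨i, h⟩).val := by
  by_contra hno
  push Not at hno
  have hk : 0 < 2 ^ k := by positivity
  have hconst : ∀ n (hn : n ≤ 2 ^ j) (t : Fin k), j ≤ t.val →
      g ⟨a + n, by omega⟩ t = g ⟨a, by omega⟩ t := by
    intro n
    induction n with
    | zero => intro _ t _; rfl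
    | succ n ih =>
      intro hn t ht
      rw [← ih (by omega) t ht]
      have h1 := hno (a + n) (by omega) (by omega) (by omega)
      have h2 := hD ⟨a + n, by omega⟩ t
      by_contra h3
      have h4 := h2.1 (fun h => h3 h.symm)
      rw [← h4] at h1
      omega
  let F : Fin (2 ^ j + 1) → (Fin j → Bool) := fun n t =>
    g ⟨a + n.val, by have := n.isLt; omega⟩ ⟨t.val, lt_of_lt_of_le t.isLt hj⟩
  have hF : Function.Injective F := by
    intro x y hxy
    have : g ⟨a + x.val, by have := x.isLt; omega⟩ = g ⟨a + y.val, by have := y.isLt; omega⟩ := by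
      funext t
      by_cases ht : t.val < j
      · exact congrFun hxy ⟨t.val, ht⟩
      · rw [hconst x.val (by have := x.isLt; omega) t (by omega),
          hconst y.val (by have := y.isLt; omega) t (by omega)]
    have h5 := hg.1.1 this
    simp only [Fin.mk.injEq] at h5
    apply Fin.ext
    omega
  have := Fintype.card_le_of_injective F hF
  simp at this

theorem standardGray_unique_transition_counts (k : ℕ) (hk : 1 ≤ k) :
    IsGrayCode k (standardGray k) ∧
      (∀ t : Fin k, grayTransCount k (standardGray k) t = 2 ^ (k - 1 - t.val)) ∧
      ∀ (g : Fin (2 ^ k) → Fin k → Bool) (D D0 : Fin (2 ^ k - 1) → Fin k),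
        IsGrayCode k g → IsDeltaOf k g D → IsDeltaOf k (standardGray k) D0 →
        (∀ t : Fin k, grayTransCount k g t = 2 ^ (k - 1 - t.val)) → D = D0 := by
  refine ⟨gw_std_gray k, gw_std_count k, ?_⟩
  intro g D D0 hg hD hD0 hc
  have hsum : ∀ f : Fin k → ℕ, ∑ i, f (D i) = ∑ i, f (D0 i) := fun f =>
    (gw_sum_delta k g D hD hc f).trans
      (gw_sum_delta k _ D0 hD0 (gw_std_count k) f).symm
  have h0 : ∀ i, 2 ^ (D0 i).val ∣ i.val + 1 ∧ ¬ 2 ^ ((D0 i).val+1) ∣ i.val + 1 := fun i =>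
    (gw_std_iff k i (D0 i)).1 ((hD0 i (D0 i)).2 rfl)
  have hle : ∀ i, (D i).val ≤ (D0 i).val := by
    intro i
    classical
    have hj : (D i).val < k := (D i).isLt
    have hdv : ∀ j : ℕ, j < k → j ≤ (D i).val → 2 ^ j ∣ i.val + 1 := by
      intro j hj hji
      have e : 2 ^ j * 2 ^ (k - j) = 2 ^ k := by rw [← pow_add]; congr 1; omega
      apply gw_dvd (fun n => ∃ h : n < 2 ^ k - 1, j ≤ (D ⟨n, h⟩).val) (2 ^ j) (2 ^ (k - j))
        (by positivity)
      · rw [e]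
        exact gw_window k g D hg hD j hj.le
      · rw [e, ← gw_fin_card]
        have h1 := hsum (fun t => if j ≤ t.val then 1 else 0)
        rw [← Finset.card_filter, ← Finset.card_filter] at h1
        have h2 : (Finset.univ.filter fun i : Fin (2 ^ k - 1) => j ≤ (D0 i).val) =
            Finset.univ.filter fun i : Fin (2 ^ k - 1) => 2 ^ j ∣ i.val + 1 := by
          apply Finset.filter_congr
          intro x _
          constructor
          · intro h
            exact (pow_dvd_pow 2 h).trans (h0 x).1
          · intro h
            by_contra hh
            exact (h0 x).2 ((pow_dvd_pow 2 (by omega)).trans h)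
        rw [h2, gw_fin_card (2 ^ k - 1) (fun i => 2 ^ j ∣ i + 1), Nat.card_multiples,
          gw_sub_div _ _ hj.le] at h1
        have h3 : (Finset.univ.filter fun x : Fin (2 ^ k - 1) =>
            ∃ h : x.val < 2 ^ k - 1, j ≤ (D ⟨x.val, h⟩).val) =
            Finset.univ.filter fun x : Fin (2 ^ k - 1) => j ≤ (D x).val := by
          apply Finset.filter_congr
          intro x _
          exact ⟨fun ⟨_, h⟩ => h, fun h => ⟨x.isLt, h⟩⟩
        have h4 : 0 < 2 ^ (k - j) := by positivity
        rw [h3, h1]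
        omega
      · rw [e]; exact i.isLt
      · exact ⟨i.isLt, hji⟩
    by_contra hh
    exact (h0 i).2 ((pow_dvd_pow 2 (by omega)).trans (hdv _ hj le_rfl))
  have := (Finset.sum_eq_sum_iff_of_le (s := Finset.univ) (fun i _ => hle i)).1
    (hsum (fun t => t.val))
  funext i
  exact Fin.ext (this i (Finset.mem_univ i))
end

section
/- Let D be a k-bit delta sequence whose shuffle count is odd. Then D lies in the S_k-orbit of the delta sequence of the standard k-bit Gray code; that is, D is obtained from the delta sequence of the standard k-bit Gray code by relabeling the symbols 1,…,k by a permutation of {1,…,k}. -/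
namespace GrayAux

variable {α : Type*} [DecidableEq α]

def Good (L : List α) : Prop :=
  ∀ A M B : List α, L = A ++ M ++ B → M ≠ [] → ∃ t, Odd (M.count t)

def DS (S : Finset α) (L : List α) : Prop :=
  (∀ x ∈ L, x ∈ S) ∧ L.length + 1 = 2 ^ S.card ∧ Good L

def pre (a : α) (d : List α) : List α := d.flatMap (fun x => [a, x])

def il (a : α) (d : List α) : List α := pre a d ++ [a]

def stdSeq : List α → List α
  | [] => []
  | a :: p => il a (stdSeq p)

theorem pre_append (a : α) (A B : List α) : pre a (A ++ B) = pre a A ++ pre a B := by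
  simp [pre]

theorem pre_cons (a x : α) (B : List α) : pre a (x :: B) = a :: x :: pre a B := by
  simp [pre]

theorem il_cons (a x : α) (B : List α) : il a (x :: B) = a :: x :: il a B := by
  simp [il, pre_cons]

theorem count_pre (a t : α) (d : List α) :
    (pre a d).count t = d.count t + if a = t then d.length else 0 := by
  induction d with
  | nil => simp [pre]
  | cons x d ih =>
    rw [pre_cons, List.count_cons, List.count_cons, ih, List.count_cons]
    by_cases h : a = t <;> simp [h] <;> omega

theorem count_il (a t : α) (d : List α) :
    (il a d).count t = d.count t + if a = t then d.length + 1 else 0 := by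
  rw [il, List.count_append, count_pre]
  by_cases h : a = t <;> simp [h]; omega

theorem length_il (a : α) (d : List α) : (il a d).length = 2 * d.length + 1 := by
  induction d with
  | nil => simp [il, pre]
  | cons x d ih => simp [il_cons, ih]; omega

theorem length_stdSeq (p : List α) : (stdSeq p).length + 1 = 2 ^ p.length := by
  induction p with
  | nil => simp [stdSeq]
  | cons a p ih => simp [stdSeq, length_il, pow_succ]; omega

theorem count_stdSeq_snoc (p : List α) (m t : α) :
    (stdSeq (p ++ [m])).count t = 2 * (stdSeq p).count t + if m = t then 1 else 0 := by
  induction p with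
  | nil => simp [stdSeq, count_il]
  | cons a p ih =>
    have h1 := length_stdSeq p
    have h2 := length_stdSeq (p ++ [m])
    simp only [List.cons_append, stdSeq, count_il, ih]
    simp [pow_succ] at h2
    split_ifs <;> omega

theorem mem_stdSeq (p : List α) (x : α) (hx : x ∈ stdSeq p) : x ∈ p := by
  induction p with
  | nil => simp [stdSeq] at hx
  | cons a p ih =>
    simp [stdSeq, il, pre] at hx
    rcases hx with ⟨y, hy, h⟩ | h
    · rcases h with rfl | rfl
      · simp
      · simp [ih hy]
    · simp [h]

theorem even_length (M : List α) (h : ∀ t, Even (M.count t)) : Even M.length := by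
  rw [← List.sum_toFinset_count_eq_length]
  exact Finset.even_sum _ (fun t _ => h t)

theorem Good.infix {A M B : List α} (h : Good (A ++ M ++ B)) : Good M := by
  intro A' M' B' e hne
  exact h (A ++ A') M' (B' ++ B) (by simp [e]) hne

theorem Good.of_il {a : α} {d : List α} (h : Good (il a d)) : Good d := by
  intro A M B e hne
  by_contra hc
  push Not at hc
  have hev : ∀ t, Even (M.count t) := fun t => by simpa using hc t
  obtain ⟨t, ht⟩ := h (pre a A) (pre a M) (pre a B ++ [a])
    (by simp [il, e, pre_append]) (by
      cases M with
      | nil => exact absurd rfl hne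
      | cons x M => simp [pre_cons])
  rw [count_pre] at ht
  have := even_length M hev
  have h3 := hev t
  rw [← Nat.not_even_iff_odd] at ht
  apply ht
  split_ifs
  · exact h3.add this
  · simpa using h3

theorem Good.reverse {L : List α} (h : Good L) : Good L.reverse := by
  intro A M B e hne
  have e2 : L = B.reverse ++ M.reverse ++ A.reverse := by
    rw [← List.reverse_reverse L, e]; simp
  obtain ⟨t, ht⟩ := h _ _ _ e2 (by simpa using hne)
  exact ⟨t, by simpa using ht⟩

theorem DS.reverse {S : Finset α} {L : List α} (h : DS S L) : DS S L.reverse :=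
  ⟨fun x hx => h.1 x (by simpa using hx), by simpa using h.2.1, h.2.2.reverse⟩

/-- no two adjacent copies -/
theorem Good.tail {x : α} {L : List α} (h : Good (x :: L)) : Good L := by
  have : Good ([x] ++ L ++ []) := by simpa using h
  exact this.infix

theorem Good.ne {x y : α} {L : List α} (h : Good (x :: y :: L)) : x ≠ y := by
  rintro rfl
  obtain ⟨t, ht⟩ := h [] [x, x] L (by simp) (by simp)
  by_cases hx : x = t
  · simp [hx] at ht; exact absurd ht (by decide)
  · simp [List.count_cons, hx] at ht

theorem count_le (a : α) : ∀ (L : List α), Good L → 2 * L.count a ≤ L.length + 1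
  | [], _ => by simp
  | [x], _ => by simp [List.count_cons]; split_ifs <;> omega
  | x :: y :: L, h => by
    have h1 := count_le a L h.tail.tail
    have h2 := h.ne
    simp only [List.count_cons, List.length_cons]
    by_cases hx : x = a
    · have : y ≠ a := fun hy => h2 (hx.trans hy.symm)
      simp [hx, this]; omega
    · simp [hx]; split_ifs <;> omega

theorem exists_il (a : α) : ∀ (L : List α), Good L → L.length + 1 ≤ 2 * L.count a →
    ∃ d, L = il a d ∧ a ∉ d
  | [], _, h => by simp at h
  | [x], _, h => by
    have : x = a := by
      by_contra hx
      simp [List.count_cons, hx] at h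
    exact ⟨[], by simp [il, pre, this], by simp⟩
  | x :: y :: L, hg, h => by
    have h2 := hg.ne
    have hx : x = a := by
      by_contra hx
      have := count_le a _ hg.tail
      rw [List.count_cons] at h
      simp [hx] at h this
      omega
    have hy : y ≠ a := fun hy => h2 (hx.trans hy.symm)
    obtain ⟨d, hd, had⟩ := exists_il a L hg.tail.tail (by
      simp [List.count_cons, hx, hy] at h; omega)
    exact ⟨y :: d, by rw [il_cons, hd, hx], by simp [had, hy.symm]⟩

theorem uniq : ∀ (p L : List α), p.Nodup → DS p.toFinset L →
    (∀ t, L.count t = (stdSeq p).count t) → L = stdSeq p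
  | [], L, _, h, _ => by
    have := h.2.1
    simp at this
    simp [stdSeq, this]
  | a :: p, L, hp, h, hc => by
    have hnd := List.nodup_cons.1 hp
    have hl := h.2.1
    rw [List.toFinset_card_of_nodup hp] at hl
    have hs := length_stdSeq p
    have hca := hc a
    rw [stdSeq, count_il] at hca
    have h0 : (stdSeq p).count a = 0 := List.count_eq_zero.2 fun hm => hnd.1 (mem_stdSeq p a hm)
    simp only [h0, if_true, hs] at hca
    simp only [List.length_cons, pow_succ] at hl
    obtain ⟨d, hd, had⟩ := exists_il a L h.2.2 (by omega)
    have hg : Good d := by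
      have := h.2.2
      rw [hd] at this
      exact this.of_il
    have hld : d.length + 1 = 2 ^ p.length := by
      rw [hd, length_il] at hl; omega
    have := uniq p d hnd.2 ⟨?_, ?_, hg⟩ ?_
    · rw [hd, this, stdSeq]
    · intro x hx
      have : x ∈ L := by
        rw [hd]; simp [il, pre]; exact Or.inl ⟨x, hx, Or.inr rfl⟩
      have := h.1 x this
      simp at this
      rcases this with rfl | this
      · exact absurd hx had
      · simpa using this
    · rw [List.toFinset_card_of_nodup hnd.2, hld]
    · intro t
      have := hc t
      rw [hd, stdSeq, count_il, count_il] at this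
      have e : d.length = (stdSeq p).length := by omega
      rw [e] at this
      omega

/-! palindromes -/

theorem good_pal {E : List α} {m : α} (hE : Good E) (hm : m ∉ E) :
    Good (E ++ [m] ++ E.reverse) := by
  intro A M B e hne
  by_cases hM : m ∈ M
  · refine ⟨m, ?_⟩
    have h1 := congrArg (List.count m) e
    have h2 : E.count m = 0 := List.count_eq_zero.2 hm
    have h3 : 0 < M.count m := List.count_pos_iff.2 hM
    simp [h2] at h1
    have : M.count m = 1 := by omega
    rw [this]; exact odd_one
  · have e' : E ++ m :: E.reverse = A ++ (M ++ B) := by simpa using e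
    rcases List.append_eq_append_iff.1 e' with ⟨C, h1, h2⟩ | ⟨C, h1, h2⟩
    · cases C with
      | nil =>
        cases M with
        | nil => exact absurd rfl hne
        | cons x M => simp at h2; simp [h2.1] at hM
      | cons x C =>
        simp at h2
        exact hE.reverse C M B (by simp [h2.2]) hne
    · rcases List.append_eq_append_iff.1 h2 with ⟨F, h3, h4⟩ | ⟨F, h3, h4⟩
      · exact hE A M F (by simp [h1, h3]) hne
      · cases F with
        | nil => exact hE A M [] (by simp [h1, h3]) hne
        | cons x F =>
          simp at h4
          simp [h3, h4.1] at hM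

theorem pal_notMem {E : List α} {m : α} (h : Good (E ++ [m] ++ E.reverse)) : m ∉ E := by
  intro hm
  obtain ⟨A, B, rfl⟩ := List.append_of_mem hm
  obtain ⟨t, ht⟩ := h A ([m] ++ B ++ [m] ++ B.reverse) ([m] ++ A.reverse) (by simp) (by simp)
  rw [← Nat.not_even_iff_odd] at ht
  apply ht
  simp only [List.count_append, List.count_reverse]
  exact ⟨[m].count t + B.count t, by omega⟩

theorem exists_pal {L : List α} (h : L.reverse = L) (n : ℕ) (hl : L.length = 2 * n + 1) :
    ∃ E m, L = E ++ [m] ++ E.reverse := by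
  have hn : n < L.length := by omega
  refine ⟨L.take n, L[n], ?_⟩
  have h1 : L.drop (n+1) = (L.take n).reverse := by
    rw [List.reverse_take, h]; congr 1; omega
  rw [← h1]
  simp

theorem ds_pal {S : Finset α} {E : List α} {m : α} (hm : m ∈ S) :
    DS S (E ++ [m] ++ E.reverse) ↔ DS (S.erase m) E := by
  have hc := Finset.card_erase_add_one hm
  constructor
  · rintro ⟨h1, h2, h3⟩
    have h4 := pal_notMem h3
    refine ⟨fun x hx => ?_, ?_, ?_⟩
    · have := h1 x (by simp [hx])
      refine Finset.mem_erase.2 ⟨?_, this⟩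
      rintro rfl; exact h4 hx
    · rw [← hc, pow_succ] at h2
      simp at h2; omega
    · have : Good ([] ++ E ++ ([m] ++ E.reverse)) := by simpa using h3
      exact this.infix
  · rintro ⟨h1, h2, h3⟩
    refine ⟨fun x hx => ?_, ?_, good_pal h3 fun hx => ?_⟩
    · simp at hx
      rcases hx with hx | rfl | hx
      · exact Finset.mem_of_mem_erase (h1 x hx)
      · exact hm
      · exact Finset.mem_of_mem_erase (h1 x hx)
    · rw [← hc, pow_succ]
      simp; omega
    · simpa using h1 m hx

def X (S : Finset α) (c : α → ℕ) : Set (List α) := {L | DS S L ∧ ∀ t, L.count t = c t}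

theorem X_finite (S : Finset α) (c : α → ℕ) : (X S c).Finite := by
  have : ({l : List S | l.length = 2 ^ S.card - 1}).Finite := List.finite_length_eq _ _
  refine (this.image (List.map Subtype.val)).subset ?_
  rintro L ⟨⟨h1, h2, _⟩, _⟩
  refine ⟨L.attach.map (fun x => ⟨x.1, h1 x.1 x.2⟩), ?_, ?_⟩
  · simp; omega
  · simp

theorem par : ∀ (k : ℕ) (S : Finset α) (c : α → ℕ), S.card = k → Odd (Nat.card (X S c)) →
    ∃ p : List α, p.Nodup ∧ p.toFinset = S ∧ ∀ t, c t = (stdSeq p).count t := by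
  intro k
  induction k with
  | zero =>
    intro S c hS hodd
    have hne : (X S c).Nonempty := by
      by_contra hc
      rw [Set.not_nonempty_iff_eq_empty] at hc
      simp [hc] at hodd
    obtain ⟨L, hL, hc⟩ := hne
    have := hL.2.1
    simp [hS] at this
    subst this
    refine ⟨[], by simp, ?_, ?_⟩
    · simp at hS; simp [hS]
    · intro t; simp [stdSeq, ← hc]
  | succ k ih =>
    intro S c hS hodd
    haveI : Finite (X S c) := (X_finite S c).to_subtype
    haveI : Fintype (X S c) := Fintype.ofFinite _
    let f : X S c → X S c := fun L => ⟨L.1.reverse, L.2.1.reverse, fun t => by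
      simpa using L.2.2 t⟩
    have hf : Function.Involutive f := fun L => by simp [f]
    have key : Odd (Nat.card {L : X S c // f L = L}) := by
      have := Equiv.Perm.card_fixedPoints_modEq (p := 2) (n := 1) (f := f)
        (by
          have h3 := pow_two (M := Function.End (X S c)) f
          exact h3.trans hf.comp_self)
      rw [Nat.card_eq_fintype_card] at hodd
      rw [Nat.odd_iff] at hodd ⊢
      rw [← hodd, this, ← Nat.card_eq_fintype_card]
      rfl
    have hne : Nonempty {L : X S c // f L = L} := by
      by_contra hc
      rw [not_nonempty_iff] at hc
      simp at key
    have hpal : ∀ L : List α, DS S L → L.reverse = L → ∃ E m, L = E ++ [m] ++ E.reverse := by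
      intro L hL hr
      apply exists_pal hr (2 ^ k - 1)
      have := hL.2.1
      have h2 : 0 < 2 ^ k := by positivity
      rw [hS, pow_succ] at this
      omega
    obtain ⟨⟨⟨L, hL, hLc⟩, hr⟩⟩ := hne
    obtain ⟨E, m, rfl⟩ := hpal L hL (congrArg Subtype.val hr)
    have hm : m ∈ S := hL.1 m (by simp)
    have hc : ∀ t, c t = 2 * E.count t + if m = t then 1 else 0 := by
      intro t
      rw [← hLc]
      simp [List.count_cons]
      omega
    have hcard : Nat.card {L : X S c // f L = L} = Nat.card (X (S.erase m) (E.count ·)) := by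
      symm
      apply Nat.card_congr
      refine Equiv.ofBijective (fun F => ⟨⟨F.1 ++ [m] ++ F.1.reverse, (ds_pal hm).2 F.2.1, ?_⟩, ?_⟩)
        ⟨?_, ?_⟩
      · intro t
        have hF : F.1.count t = E.count t := F.2.2 t
        rw [hc, ← hF]
        simp [List.count_cons]
        omega
      · simp [f]
      · intro F G h
        simp at h
        have := (List.append_inj' h (by
          have := congrArg List.length h
          simp at this ⊢
          omega)).1
        exact Subtype.ext this
      · rintro ⟨⟨L, hL', hLc'⟩, hr'⟩
        obtain ⟨F, n, rfl⟩ := hpal L hL' (congrArg Subtype.val hr')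
        have hc' : ∀ t, c t = 2 * F.count t + if n = t then 1 else 0 := by
          intro t
          rw [← hLc']
          simp [List.count_cons]
          omega
        have hnm : n = m := by
          by_contra hnm
          have h1 := hc m
          rw [hc' m] at h1
          simp [hnm] at h1
          omega
        subst hnm
        refine ⟨⟨F, (ds_pal hm).1 hL', fun t => ?_⟩, ?_⟩
        · have h1 := hc t
          rw [hc' t] at h1
          simp only
          omega
        · simp
    rw [hcard] at key
    obtain ⟨p, hp, hpS, hpc⟩ := ih (S.erase m) _ (by rw [Finset.card_erase_of_mem hm, hS]; rfl) key
    have hmp : m ∉ p := fun h => by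
      have : m ∈ p.toFinset := by simpa using h
      rw [hpS] at this
      simp at this
    refine ⟨p ++ [m], ?_, ?_, ?_⟩
    · rw [List.nodup_append]
      refine ⟨hp, by simp, ?_⟩
      intro a ha b hb
      simp at hb
      rintro rfl
      subst hb
      exact hmp ha
    · rw [List.toFinset_append, hpS]
      ext x
      by_cases hx : x = m <;> simp [hx, hm]
    · intro t
      rw [count_stdSeq_snoc, hc, hpc]

/-! bridge -/

theorem std_get : ∀ (k i : ℕ), i + 1 < 2 ^ k → ∃ t, t < k ∧
    Nat.testBit (i ^^^ (i / 2)) t ≠ Nat.testBit ((i + 1) ^^^ ((i + 1) / 2)) t ∧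
    ∀ {β : Type} [DecidableEq β] (p : List β), p.length = k → (stdSeq p)[i]? = p[t]? := by
  have hil : ∀ {β : Type} [DecidableEq β] (a : β) (d : List β) (i : ℕ), i ≤ d.length →
      (il a d)[2 * i]? = some a ∧ (il a d)[2 * i + 1]? = d[i]? := by
    intro β _ a d
    induction d with
    | nil => intro i hi; simp at hi; subst hi; simp [il, pre]
    | cons x d ih =>
      intro i hi
      rw [il_cons]
      cases i with
      | zero => simp
      | succ i =>
        have := ih i (by simpa using hi)
        simpa [Nat.mul_add] using this
  intro k
  induction k with
  | zero => intro i hi; simp at hi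
  | succ k ih =>
    intro i hi
    rw [pow_succ] at hi
    obtain ⟨j, rfl | rfl⟩ : ∃ j, i = 2 * j ∨ i = 2 * j + 1 := ⟨i / 2, by omega⟩
    · refine ⟨0, by omega, ?_, ?_⟩
      · have h1 : (2 * j + 1) / 2 = j := by omega
        have h2 : 2 * j / 2 = j := by omega
        rw [h1, h2, Nat.testBit_xor, Nat.testBit_xor]
        have h3 : (2 * j).testBit 0 = false := by simp
        have h4 : (2 * j + 1).testBit 0 = true := by simp
        rw [h3, h4]
        cases j.testBit 0 <;> simp
      · intro β _ p hp
        cases p with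
        | nil => simp at hp
        | cons a p =>
          have := length_stdSeq p
          simp at hp
          rw [hp] at this
          rw [stdSeq, (hil a _ j (by omega)).1]
          simp
    · obtain ⟨t, ht, hne, hp⟩ := ih j (by omega)
      refine ⟨t + 1, by omega, ?_, ?_⟩
      · have h1 : (2 * j + 1) / 2 = j := by omega
        have h2 : (2 * j + 1 + 1) / 2 = j + 1 := by omega
        rw [Nat.testBit_xor, Nat.testBit_xor] at hne
        rw [Nat.testBit_xor, Nat.testBit_xor, Nat.testBit_succ, Nat.testBit_succ, Nat.testBit_succ,
          Nat.testBit_succ, h1, h2]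
        exact hne
      · intro β _ p hpl
        cases p with
        | nil => simp at hpl
        | cons a p =>
          have := length_stdSeq p
          simp at hpl
          rw [hpl] at this
          rw [stdSeq, (hil a _ j (by omega)).2, hp p hpl]
          simp

theorem count_ofFn {n k : ℕ} (D : Fin n → Fin k) (t : Fin k) :
    (List.ofFn D).count t = transCount D t := by
  rw [List.ofFn_eq_map, List.count, List.countP_map, List.countP_eq_length_filter, transCount,
    ← List.toFinset_card_of_nodup ((List.nodup_finRange n).filter _)]
  congr 1
  ext i
  simp

theorem ds_of_delta {k : ℕ} {D : Fin (2 ^ k - 1) → Fin k} (h : IsDeltaSequence k D) :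
    DS Finset.univ (List.ofFn D) := by
  obtain ⟨g, ⟨hb, -⟩, hd⟩ := h
  have hpos : 0 < 2 ^ k := by positivity
  refine ⟨by simp, by simp; omega, ?_⟩
  have key : ∀ (j : ℕ) (hj : j < 2 ^ k) (t : Fin k),
      g ⟨j, hj⟩ t = xor (g ⟨0, hpos⟩ t) (decide (Odd (((List.ofFn D).take j).count t))) := by
    intro j
    induction j with
    | zero => intro hj t; simp
    | succ j ih =>
      intro hj t
      have hj' : j < 2 ^ k - 1 := by omega
      have h1 := ih (by omega) t
      have h2 := hd ⟨j, hj'⟩ t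
      simp only [finLo, finHi] at h2
      rw [List.take_add_one, List.getElem?_ofFn, dif_pos hj', List.count_append]
      by_cases ht : t = D ⟨j, hj'⟩
      · have h3 := h2.2 ht
        rw [h1] at h3
        simp [ht, Nat.odd_add_one, -Nat.not_odd_iff_even] at h3 ⊢
        revert h3
        generalize decide (Odd (List.count (D ⟨j, hj'⟩) (List.take j (List.ofFn D)))) = b
        cases g ⟨0, hpos⟩ (D ⟨j, hj'⟩) <;> cases g ⟨j + 1, hj⟩ (D ⟨j, hj'⟩) <;> cases b <;> simp
      · have h3 := (not_congr h2).2 ht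
        have ht' : ¬ (D ⟨j, hj'⟩ = t) := fun h => ht h.symm
        simp only [ne_eq, not_not] at h3
        rw [← h3, h1]
        simp [List.count_cons, ht']
  intro A M B e hne
  have hlen := congrArg List.length e
  simp at hlen
  have hM : 0 < M.length := List.length_pos_iff.2 hne
  have hgne : g ⟨A.length, by omega⟩ ≠ g ⟨A.length + M.length, by omega⟩ := by
    intro hc
    have := hb.1 hc
    simp at this
    exact hne this
  obtain ⟨t, ht⟩ := Function.ne_iff.1 hgne
  refine ⟨t, ?_⟩
  by_contra hodd
  apply ht
  rw [key A.length, key (A.length + M.length), e]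
  have e1 : (A ++ M ++ B).take A.length = A := by simp
  have e2 : (A ++ M ++ B).take (A.length + M.length) = A ++ M := by
    rw [← List.length_append, List.take_left]
  rw [e1, e2, List.count_append]
  congr 1
  rw [decide_eq_decide, Nat.odd_add, ← Nat.not_odd_iff_even]
  tauto

theorem delta_of_ds {k : ℕ} {D : Fin (2 ^ k - 1) → Fin k}
    (h : DS Finset.univ (List.ofFn D)) : IsDeltaSequence k D := by
  let g : Fin (2 ^ k) → Fin k → Bool := fun j t => decide (Odd (((List.ofFn D).take j).count t))
  have hd : IsDeltaOf k g D := by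
    intro i t
    simp only [g, finLo, finHi]
    rw [List.take_add_one, List.getElem?_ofFn, dif_pos i.2, List.count_append]
    by_cases ht : t = D i
    · simp [ht, Nat.odd_add_one, -Nat.not_odd_iff_even]
    · have ht' : ¬ (D i = t) := fun h => ht h.symm
      simp [List.count_cons, ht, ht']
  have hlt : ∀ i j : Fin (2 ^ k), i < j → g i ≠ g j := by
    intro i j hij hc
    have hij' : i.1 < j.1 := hij
    have hj := j.2
    obtain ⟨t, ht⟩ := h.2.2 ((List.ofFn D).take i) (((List.ofFn D).take j).drop i)
      ((List.ofFn D).drop j) (by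
        have : (List.ofFn D).take i = ((List.ofFn D).take j).take i := by
          rw [List.take_take, min_eq_left hij'.le]
        rw [this, List.take_append_drop, List.take_append_drop]) (by
        intro h0
        have := congrArg List.length h0
        simp at this
        omega)
    have h1 := congrFun hc t
    have h2 : ((List.ofFn D).take j).count t = ((List.ofFn D).take i).count t +
        (((List.ofFn D).take j).drop i).count t := by
      have : (List.ofFn D).take i = ((List.ofFn D).take j).take i := by
        rw [List.take_take, min_eq_left hij'.le]
      rw [this, ← List.count_append, List.take_append_drop]
    simp only [g, decide_eq_decide] at h1
    rw [h2, Nat.odd_add, ← Nat.not_odd_iff_even] at h1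
    tauto
  have hinj : Function.Injective g := by
    intro i j hij
    rcases lt_trichotomy i j with h | h | h
    · exact absurd hij (hlt _ _ h)
    · exact h
    · exact absurd hij.symm (hlt _ _ h)
  refine ⟨g, ⟨(Fintype.bijective_iff_injective_and_card g).2 ⟨hinj, by simp⟩, ?_⟩, hd⟩
  intro i
  exact ⟨D i, (hd i _).2 rfl, fun t ht => (hd i t).1 ht⟩

end GrayAux


/-- If the shuffle count of a `k`-bit delta sequence `D` (the number of `k`-bit delta
sequences with the same transition counts as `D`) is odd, then `D` lies in the
`S_k`-orbit of the delta sequence of the standard `k`-bit Gray code, i.e. it is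
obtained from it by relabeling the symbols by a permutation of `Fin k`. -/
theorem odd_shuffleCount_standard (k : ℕ) (hk : 1 ≤ k)
    (D : Fin (2 ^ k - 1) → Fin k) (hD : IsDeltaSequence k D)
    (hodd : Odd (Nat.card {D' : Fin (2 ^ k - 1) → Fin k //
      IsDeltaSequence k D' ∧ ∀ t, transCount D' t = transCount D t})) :
    ∀ D0 : Fin (2 ^ k - 1) → Fin k, IsDeltaOf k (standardGray k) D0 →
      ∃ σ : Equiv.Perm (Fin k), D = σ ∘ D0 := by
  intro D0 hD0
  have hpos : 0 < 2 ^ k := by positivity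
  have hcard : Nat.card {D' : Fin (2 ^ k - 1) → Fin k //
      IsDeltaSequence k D' ∧ ∀ t, transCount D' t = transCount D t} =
      Nat.card (GrayAux.X (Finset.univ : Finset (Fin k)) (transCount D)) := by
    apply Nat.card_congr
    refine Equiv.ofBijective (fun D' => ⟨List.ofFn D'.1, GrayAux.ds_of_delta D'.2.1,
      fun t => by rw [GrayAux.count_ofFn, D'.2.2]⟩) ⟨?_, ?_⟩
    · intro A B h
      exact Subtype.ext (List.ofFn_injective (congrArg Subtype.val h))
    · rintro ⟨L, hL, hLc⟩
      have hl : L.length = 2 ^ k - 1 := by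
        have := hL.2.1
        simp at this
        omega
      have hof : List.ofFn (fun i : Fin (2 ^ k - 1) => L[i.1]'(by omega)) = L := by
        apply List.ext_getElem
        · simp [hl]
        · simp
      refine ⟨⟨fun i => L[i.1]'(by omega), GrayAux.delta_of_ds (by rwa [hof]), fun t => ?_⟩, ?_⟩
      · rw [← GrayAux.count_ofFn, hof, hLc]
      · exact Subtype.ext hof
  rw [hcard] at hodd
  obtain ⟨p, hp, hpS, hpc⟩ := GrayAux.par k _ _ (by simp) hodd
  have hL := GrayAux.uniq p (List.ofFn D) hp (by rw [hpS]; exact GrayAux.ds_of_delta hD)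
    (fun t => by rw [GrayAux.count_ofFn, hpc])
  have hpl : p.length = k := by
    rw [← List.toFinset_card_of_nodup hp, hpS]; simp
  let s : Fin k → Fin k := fun j => p[j.1]'(by omega)
  have hs : Function.Injective s := by
    intro i j hij
    exact Fin.ext ((hp.getElem_inj_iff).1 hij)
  refine ⟨Equiv.ofBijective s (Finite.injective_iff_bijective.1 hs), ?_⟩
  funext i
  obtain ⟨t, ht, hne, hget⟩ := GrayAux.std_get k i.1 (by omega)
  have h0 : (⟨t, ht⟩ : Fin k) = D0 i := (hD0 i ⟨t, ht⟩).1 hne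
  have h1 := hget p hpl
  rw [← hL, List.getElem?_ofFn, dif_pos i.2, List.getElem?_eq_getElem (by omega)] at h1
  simp only [Option.some.injEq] at h1
  simp only [Function.comp, Equiv.ofBijective_apply, ← h0, s]
  exact h1
end

section
/- Let D be a k-bit delta sequence and let 0 ≤ i < k be such that c_k(D) = 1, c_{k−1}(D) = 2, …, c_{k−i+1}(D) = 2^{i−1} (that is, c_{k−m}(D) = 2^m for all 0 ≤ m < i). Then c_{k−i}(D) ≥ 2^i. -/
/-- If `D` is a `k`-bit delta sequence with `c_{k-m}(D) = 2^m` for all `0 ≤ m < i`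
(rows indexed `1,…,k`, so row `k-m` is index `k-m-1` in `Fin k`), then
`c_{k-i}(D) ≥ 2^i`. -/
theorem transCount_lower_bound (k : ℕ) (D : Fin (2 ^ k - 1) → Fin k)
    (hD : IsDeltaSequence k D) (i : ℕ) (hi : i < k)
    (h : ∀ m : ℕ, (hm : m < i) → transCount D ⟨k - m - 1, by omega⟩ = 2 ^ m) :
    2 ^ i ≤ transCount D ⟨k - i - 1, by omega⟩ := by
  obtain ⟨g, ⟨hb, -⟩, hg⟩ := hD
  let c : Fin (i + 1) → Fin k := fun m => ⟨k - m.val - 1, by omega⟩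
  let p : (Fin k → Bool) → (Fin (i + 1) → Bool) := fun v m => v (c m)
  let J : Finset (Fin (2 ^ k - 1)) :=
    Finset.univ.biUnion fun m : Fin (i + 1) => Finset.univ.filter fun j => D j = c m
  have hpos : 0 < 2 ^ k := pow_pos (by norm_num) k
  let U : Finset (Fin (i + 1) → Bool) :=
    insert (p (g ⟨0, hpos⟩)) (J.image fun j => p (g (finHi k j)))
  have hU : ∀ n : ℕ, ∀ hn : n < 2 ^ k, p (g ⟨n, hn⟩) ∈ U := by
    intro n
    induction n with
    | zero => intro hn; exact Finset.mem_insert_self _ _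
    | succ n ih =>
      intro hn
      have hj : n < 2 ^ k - 1 := by omega
      by_cases hJ : (⟨n, hj⟩ : Fin (2 ^ k - 1)) ∈ J
      · exact Finset.mem_insert_of_mem (Finset.mem_image.2 ⟨⟨n, hj⟩, hJ, rfl⟩)
      · have h1 := ih (by omega)
        have h2 : p (g ⟨n + 1, hn⟩) = p (g ⟨n, by omega⟩) := by
          funext m
          by_contra hne
          apply hJ
          refine Finset.mem_biUnion.2 ⟨m, Finset.mem_univ _, ?_⟩
          refine Finset.mem_filter.2 ⟨Finset.mem_univ _, ?_⟩
          exact ((hg ⟨n, hj⟩ (c m)).1 (fun e => hne e.symm)).symm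
        rw [h2]; exact h1
  have hUuniv : U = Finset.univ := by
    apply Finset.eq_univ_of_forall
    intro w
    obtain ⟨v, hv⟩ : ∃ v, p v = w := by
      refine ⟨fun t => if ht : k - t.val - 1 < i + 1 then w ⟨k - t.val - 1, ht⟩ else false, ?_⟩
      funext m
      have hm := m.isLt
      have e : k - (k - m.val - 1) - 1 = m.val := by omega
      simp only [p, c, e]
      simp [hm]
    obtain ⟨n, rfl⟩ := hb.2 v
    rw [← hv]
    exact hU n.val n.isLt
  have hc1 : U.card = 2 ^ (i + 1) := by rw [hUuniv]; simp
  have hc2 : U.card ≤ J.card + 1 :=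
    (Finset.card_insert_le _ _).trans (Nat.add_le_add_right Finset.card_image_le 1)
  have hc3 : J.card ≤ ∑ m : Fin (i + 1), transCount D (c m) := Finset.card_biUnion_le
  rw [Fin.sum_univ_castSucc] at hc3
  have hs : ∑ m : Fin i, transCount D (c m.castSucc) = 2 ^ i - 1 := by
    rw [Finset.sum_congr rfl fun m _ => h m.val m.isLt, Fin.sum_univ_eq_sum_range (fun m => 2 ^ m)]
    exact Nat.geomSum_eq le_rfl i |>.trans (by simp)
  rw [hs] at hc3
  have hl : c (Fin.last i) = ⟨k - i - 1, by omega⟩ := rfl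
  rw [hl] at hc3
  have : 0 < 2 ^ i := pow_pos (by norm_num) i
  rw [pow_succ] at hc1
  omega
end
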